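/- Let p be a prime and k a field with CharP k p. Let V, W be k-vector spaces, and let Θ : V^{⊗p} ⊗ W^{⊗p} → (V ⊗ W)^{⊗p} be the canonical interleaving isomorphism sending (v_0 ⊗ ⋯ ⊗ v_{p-1}) ⊗ (w_0 ⊗ ⋯ ⊗ w_{p-1}) to (v_0 ⊗ w_0) ⊗ ⋯ ⊗ (v_{p-1} ⊗ w_{p-1}). Then: (1) Θ maps ker(id - σ_V) ⊗ ker(id - σ_W) into ker(id - σ_{V⊗W}); (2) Θ maps im(N_V) ⊗ ker(id - σ_W) and ker(id - σ_V) ⊗ im(N_W) into im(N_{V⊗W}); (3) the induced k-linear map T(V) ⊗ T(W) → T(V ⊗ W) is bijective. -/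

import Mathlib

open scoped TensorProduct

noncomputable section

/-- The cyclic shift `σ_M` on `M^{⊗p}`, induced by the cyclic permutation `i ↦ i + 1`
of `Fin p`, so that `σ_M (m_0 ⊗ ⋯ ⊗ m_{p-1}) = m_{p-1} ⊗ m_0 ⊗ ⋯ ⊗ m_{p-2}`. -/
def cyclicShift (k : Type*) [Field k] (p : ℕ) (M : Type*) [AddCommGroup M]
    [Module k M] : Module.End k (⨂[k] _ : Fin p, M) :=
  (PiTensorProduct.reindex k (fun _ : Fin p => M) (finRotate p)).toLinearMap

/-- The norm operator `N_M := Σ_{j=0}^{p-1} σ_M^j` on `M^{⊗p}`. -/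
def normOp (k : Type*) [Field k] (p : ℕ) (M : Type*) [AddCommGroup M] [Module k M] :
    Module.End k (⨂[k] _ : Fin p, M) :=
  ∑ j ∈ Finset.range p, (cyclicShift k p M) ^ j

/-- The kernel of `id - σ_M` inside `M^{⊗p}`. -/
def kerShift (k : Type*) [Field k] (p : ℕ) (M : Type*) [AddCommGroup M]
    [Module k M] : Submodule k (⨂[k] _ : Fin p, M) :=
  LinearMap.ker (LinearMap.id - cyclicShift k p M)

/-- The image of the norm `N_M`, viewed as a submodule of `ker (id - σ_M)`. -/
def normImage (k : Type*) [Field k] (p : ℕ) (M : Type*) [AddCommGroup M]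
    [Module k M] : Submodule k (kerShift k p M) :=
  Submodule.comap (kerShift k p M).subtype (LinearMap.range (normOp k p M))

/-- The Tate construction `T(M) := ker (id - σ_M) / im (N_M)`. -/
abbrev Tate (k : Type*) [Field k] (p : ℕ) (M : Type*) [AddCommGroup M]
    [Module k M] : Type _ :=
  kerShift k p M ⧸ normImage k p M

open Module

section TateCoefficients

variable {k : Type*} [Field k] {p : ℕ} {M : Type*} [AddCommGroup M] [Module k M]
  {I : Type*}

theorem mem_kerShift {x : ⨂[k] _ : Fin p, M} :
    x ∈ kerShift k p M ↔ cyclicShift k p M x = x := by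
  rw [kerShift, LinearMap.mem_ker, LinearMap.sub_apply, LinearMap.id_apply, sub_eq_zero, eq_comm]

theorem cyclicShift_tprod (v : Fin p → M) :
    cyclicShift k p M (PiTensorProduct.tprod k v) =
      PiTensorProduct.tprod k fun i => v ((finRotate p).symm i) := by
  simp [cyclicShift]

theorem cyclicShift_pow_apply_of_mem {x : ⨂[k] _ : Fin p, M} (hx : x ∈ kerShift k p M) (j : ℕ) :
    (cyclicShift k p M ^ j) x = x := by
  induction j with
  | zero => simp
  | succ j ih => rw [pow_succ, Module.End.mul_apply, mem_kerShift.1 hx, ih]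

/-- `σ_M` permutes the coordinates of a tensor with respect to a product basis. -/
theorem repr_cyclicShift (b : Basis I k M) (x : ⨂[k] _ : Fin p, M) (f : Fin p → I) :
    (Basis.piTensorProduct fun _ => b).repr (cyclicShift k p M x) f =
      (Basis.piTensorProduct fun _ => b).repr x (f ∘ finRotate p) := by
  induction x using PiTensorProduct.induction_on with
  | smul_tprod r v =>
    rw [map_smul, cyclicShift_tprod]
    simp only [map_smul, Finsupp.smul_apply, Basis.piTensorProduct_repr_tprod_apply,
      Function.comp_apply]
    congr 1
    exact Fintype.prod_equiv (finRotate p).symm _ _ fun i => by simp only [Equiv.apply_symm_apply]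
  | add x y hx hy => simp only [map_add, Finsupp.add_apply, hx, hy]

theorem repr_cyclicShift_pow (b : Basis I k M) (j : ℕ) (x : ⨂[k] _ : Fin p, M)
    (f : Fin p → I) :
    (Basis.piTensorProduct fun _ => b).repr ((cyclicShift k p M ^ j) x) f =
      (Basis.piTensorProduct fun _ => b).repr x (f ∘ ⇑(finRotate p ^ j)) := by
  induction j generalizing f with
  | zero => rfl
  | succ j ih =>
    rw [pow_succ', Module.End.mul_apply, repr_cyclicShift, ih, pow_succ', Equiv.Perm.coe_mul,
      Function.comp_assoc]

theorem repr_normOp (b : Basis I k M) (x : ⨂[k] _ : Fin p, M) (f : Fin p → I) :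
    (Basis.piTensorProduct fun _ => b).repr (normOp k p M x) f =
      ∑ j ∈ Finset.range p,
        (Basis.piTensorProduct fun _ => b).repr x (f ∘ ⇑(finRotate p ^ j)) := by
  simp [normOp, LinearMap.sum_apply, Finsupp.finsetSum_apply, repr_cyclicShift_pow]

/-- The coordinates of a tensor at the pure powers `b i ⊗ ⋯ ⊗ b i` of the basis vectors. -/
def diagCoeff [NeZero p] (b : Basis I k M) : (⨂[k] _ : Fin p, M) →ₗ[k] I →₀ k :=
  Finsupp.lcomapDomain (fun i (_ : Fin p) => i) (fun _ _ h => congrFun h 0) ∘ₗ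
    (Basis.piTensorProduct fun _ => b).repr.toLinearMap

theorem diagCoeff_apply [NeZero p] (b : Basis I k M) (x : ⨂[k] _ : Fin p, M) (i : I) :
    diagCoeff b x i = (Basis.piTensorProduct fun _ => b).repr x fun _ => i :=
  rfl

theorem diagCoeff_tprod [NeZero p] (b : Basis I k M) (v : Fin p → M) (i : I) :
    diagCoeff b (PiTensorProduct.tprod k v) i = ∏ a, b.repr (v a) i := by
  rw [diagCoeff_apply, Basis.piTensorProduct_repr_tprod_apply]

theorem diagCoeff_normOp [NeZero p] [CharP k p] (b : Basis I k M) (x : ⨂[k] _ : Fin p, M) :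
    diagCoeff b (normOp k p M x) = 0 := by
  ext i
  rw [diagCoeff_apply, repr_normOp]
  simp [Function.comp_def]

theorem sum_range_finRotate_pow {A : Type*} [AddCommMonoid A] [NeZero p] (u : Fin p → A) :
    ∑ j ∈ Finset.range p, u ((finRotate p ^ j) 0) = ∑ a, u a := by
  obtain ⟨n, rfl⟩ := Nat.exists_eq_succ_of_ne_zero (NeZero.ne p)
  have h (j : ℕ) : (finRotate (n + 1) ^ j) 0 = Fin.ofNat (n + 1) j := by
    induction j with
    | zero => rfl
    | succ j ih => ext; simp [pow_succ', ih, Fin.val_add]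
  rw [Finset.sum_range]
  simp [h]

/-- A weight on the nonconstant functions `Fin p → I` whose sum over each rotation orbit is `1`:
up to a scalar, it detects whether `f 0` is a value of `f` chosen in terms of the range of `f`. -/
theorem exists_weight_sum_finRotate_eq_one (k : Type*) [Field k] [CharP k p] [NeZero p]
    (I : Type*) :
    ∃ h : (Fin p → I) → k, ∀ f : Fin p → I, (∀ i, f ≠ fun _ => i) →
      ∑ j ∈ Finset.range p, h (f ∘ ⇑(finRotate p ^ j)) = 1 := by
  classical
  let value (f : Fin p → I) : I := (Set.range_nonempty f).some
  let count (f : Fin p → I) : ℕ := {a | f a = value f}.toFinset.card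
  have value_comp (f : Fin p → I) (e : Equiv.Perm (Fin p)) : value (f ∘ e) = value f := by
    simp only [value, EquivLike.range_comp]
  have count_comp (f : Fin p → I) (e : Equiv.Perm (Fin p)) : count (f ∘ e) = count f := by
    simp only [count, value_comp]
    exact Finset.card_equiv e (by simp)
  refine ⟨fun f => if f 0 = value f then (count f : k)⁻¹ else 0, fun f hf => ?_⟩
  simp only [value_comp, count_comp, Function.comp_apply]
  rw [sum_range_finRotate_pow fun a => if f a = value f then (count f : k)⁻¹ else 0]
  have hcount : (count f : k) ≠ 0 := by
    rw [Ne, CharP.cast_eq_zero_iff k p]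
    refine Nat.not_dvd_of_pos_of_lt (Finset.card_pos.2 ?_) ?_
    · obtain ⟨a, ha⟩ := (Set.range_nonempty f).some_mem
      exact ⟨a, by simpa using ha⟩
    · obtain ⟨a, ha⟩ := Function.ne_iff.1 (hf (value f))
      simpa [count] using Finset.card_lt_univ_of_notMem (s := {a | f a = value f}.toFinset) (x := a)
        (by simpa using ha)
  rw [← Finset.sum_filter, Finset.sum_const, nsmul_eq_mul]
  convert mul_inv_cancel₀ hcount using 3
  simp [count]

theorem mem_range_normOp_iff [NeZero p] [CharP k p] (b : Basis I k M)
    {x : ⨂[k] _ : Fin p, M} (hx : x ∈ kerShift k p M) :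
    x ∈ LinearMap.range (normOp k p M) ↔ diagCoeff b x = 0 := by
  refine ⟨?_, fun hd => ?_⟩
  · rintro ⟨y, rfl⟩
    exact diagCoeff_normOp b y
  obtain ⟨h, hh⟩ := exists_weight_sum_finRotate_eq_one (p := p) k I
  let B : Basis (Fin p → I) k (⨂[k] _ : Fin p, M) := Basis.piTensorProduct fun _ => b
  refine ⟨B.repr.symm (Finsupp.onFinset (B.repr x).support (fun f => h f * B.repr x f)
    fun f hf => Finsupp.mem_support_iff.2 (right_ne_zero_of_mul hf)), B.repr.injective ?_⟩
  ext f
  have hinv (j : ℕ) : B.repr x (f ∘ ⇑(finRotate p ^ j)) = B.repr x f := by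
    rw [← repr_cyclicShift_pow b j x f, cyclicShift_pow_apply_of_mem hx]
  rw [repr_normOp]
  simp only [B.repr.apply_symm_apply, Finsupp.onFinset_apply, hinv, ← Finset.sum_mul, B]
  by_cases hf : ∃ i, f = fun _ => i
  · obtain ⟨i, rfl⟩ := hf
    rw [← diagCoeff_apply, hd, Finsupp.zero_apply, mul_zero]
  · rw [hh f (not_exists.1 hf), one_mul]

theorem diagCoeff_surjective_on_kerShift [NeZero p] (b : Basis I k M) :
    Function.Surjective (diagCoeff b ∘ₗ (kerShift k p M).subtype) := by
  rw [← LinearMap.range_eq_top, eq_top_iff, ← Finsupp.basisSingleOne.span_eq, Submodule.span_le]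
  rintro _ ⟨i, rfl⟩
  refine ⟨⟨PiTensorProduct.tprod k fun _ => b i, mem_kerShift.2 (cyclicShift_tprod _)⟩, ?_⟩
  classical
  ext i'
  simp [diagCoeff_tprod, Finsupp.single_apply, NeZero.ne]

/-- A basis of `M` indexed by `I` identifies `T(M)` with `I →₀ k`. -/
def tateEquiv [NeZero p] [CharP k p] (b : Basis I k M) : Tate k p M ≃ₗ[k] I →₀ k :=
  Submodule.quotEquivOfEq _ _ (by
    ext x
    exact mem_range_normOp_iff b x.2) ≪≫ₗ
    LinearMap.quotKerEquivOfSurjective _ (diagCoeff_surjective_on_kerShift b)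

theorem tateEquiv_mk [NeZero p] [CharP k p] (b : Basis I k M) (x : kerShift k p M) :
    tateEquiv b (Submodule.Quotient.mk x) = diagCoeff b (x : ⨂[k] _ : Fin p, M) :=
  rfl

end TateCoefficients

section Interleaving

variable {k : Type*} [Field k] {p : ℕ} {V W : Type*} [AddCommGroup V] [Module k V]
  [AddCommGroup W] [Module k W]
  {Θ : ((⨂[k] _ : Fin p, V) ⊗[k] (⨂[k] _ : Fin p, W)) →ₗ[k] (⨂[k] _ : Fin p, V ⊗[k] W)}

theorem interleave_cyclicShift
    (hΘ : ∀ (v : Fin p → V) (w : Fin p → W),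
      Θ ((PiTensorProduct.tprod k v) ⊗ₜ[k] (PiTensorProduct.tprod k w)) =
        PiTensorProduct.tprod k (fun i : Fin p => v i ⊗ₜ[k] w i))
    (x : ⨂[k] _ : Fin p, V) (y : ⨂[k] _ : Fin p, W) :
    Θ (cyclicShift k p V x ⊗ₜ[k] cyclicShift k p W y) =
      cyclicShift k p (V ⊗[k] W) (Θ (x ⊗ₜ[k] y)) := by
  suffices h : Θ ∘ₗ TensorProduct.map (cyclicShift k p V) (cyclicShift k p W) =
      cyclicShift k p (V ⊗[k] W) ∘ₗ Θ from LinearMap.congr_fun h (x ⊗ₜ[k] y)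
  ext v w
  simp [cyclicShift_tprod, hΘ]

theorem interleave_cyclicShift_pow
    (hΘ : ∀ (v : Fin p → V) (w : Fin p → W),
      Θ ((PiTensorProduct.tprod k v) ⊗ₜ[k] (PiTensorProduct.tprod k w)) =
        PiTensorProduct.tprod k (fun i : Fin p => v i ⊗ₜ[k] w i))
    (j : ℕ) (x : ⨂[k] _ : Fin p, V) (y : ⨂[k] _ : Fin p, W) :
    Θ ((cyclicShift k p V ^ j) x ⊗ₜ[k] (cyclicShift k p W ^ j) y) =
      (cyclicShift k p (V ⊗[k] W) ^ j) (Θ (x ⊗ₜ[k] y)) := by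
  induction j with
  | zero => simp
  | succ j ih =>
    simp only [pow_succ', Module.End.mul_apply, interleave_cyclicShift hΘ, ih]

theorem diagCoeff_interleave [NeZero p] {I J : Type*} (b : Basis I k V) (c : Basis J k W)
    (hΘ : ∀ (v : Fin p → V) (w : Fin p → W),
      Θ ((PiTensorProduct.tprod k v) ⊗ₜ[k] (PiTensorProduct.tprod k w)) =
        PiTensorProduct.tprod k (fun i : Fin p => v i ⊗ₜ[k] w i))
    (x : ⨂[k] _ : Fin p, V) (y : ⨂[k] _ : Fin p, W) :
    diagCoeff (b.tensorProduct c) (Θ (x ⊗ₜ[k] y)) =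
      finsuppTensorFinsupp' k I J (diagCoeff b x ⊗ₜ[k] diagCoeff c y) := by
  suffices h : diagCoeff (b.tensorProduct c) ∘ₗ Θ =
      (finsuppTensorFinsupp' k I J).toLinearMap ∘ₗ
        TensorProduct.map (diagCoeff b) (diagCoeff c) from LinearMap.congr_fun h (x ⊗ₜ[k] y)
  ext v w ⟨i, j⟩
  simp [hΘ, diagCoeff_tprod, Finset.prod_mul_distrib, mul_comm]

end Interleaving

/-- Monoidality of the Tate construction: for the canonical interleaving map
`Θ : V^{⊗p} ⊗ W^{⊗p} → (V ⊗ W)^{⊗p}`, characterized by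
`Θ ((v_0 ⊗ ⋯ ⊗ v_{p-1}) ⊗ (w_0 ⊗ ⋯ ⊗ w_{p-1})) = (v_0 ⊗ w_0) ⊗ ⋯ ⊗ (v_{p-1} ⊗ w_{p-1})`:
(1) `Θ` maps `ker(id - σ_V) ⊗ ker(id - σ_W)` into `ker(id - σ_{V⊗W})`;
(2) `Θ` maps `im N_V ⊗ ker(id - σ_W)` and `ker(id - σ_V) ⊗ im N_W` into `im N_{V⊗W}`;
(3) the induced map `T(V) ⊗ T(W) → T(V ⊗ W)` is bijective. -/
theorem tate_monoidal (p : ℕ) (hp : p.Prime) (k : Type*) [Field k] [CharP k p]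
    (V W : Type*) [AddCommGroup V] [Module k V] [AddCommGroup W] [Module k W]
    (Θ : ((⨂[k] _ : Fin p, V) ⊗[k] (⨂[k] _ : Fin p, W)) →ₗ[k] (⨂[k] _ : Fin p, V ⊗[k] W))
    (hΘ : ∀ (v : Fin p → V) (w : Fin p → W),
      Θ ((PiTensorProduct.tprod k v) ⊗ₜ[k] (PiTensorProduct.tprod k w)) =
        PiTensorProduct.tprod k (fun i : Fin p => v i ⊗ₜ[k] w i)) :
    (∀ v ∈ kerShift k p V, ∀ w ∈ kerShift k p W,
      Θ (v ⊗ₜ[k] w) ∈ kerShift k p (V ⊗[k] W)) ∧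
    (∀ v ∈ LinearMap.range (normOp k p V), ∀ w ∈ kerShift k p W,
      Θ (v ⊗ₜ[k] w) ∈ LinearMap.range (normOp k p (V ⊗[k] W))) ∧
    (∀ v ∈ kerShift k p V, ∀ w ∈ LinearMap.range (normOp k p W),
      Θ (v ⊗ₜ[k] w) ∈ LinearMap.range (normOp k p (V ⊗[k] W))) ∧
    ∃ θ : (Tate k p V ⊗[k] Tate k p W) →ₗ[k] Tate k p (V ⊗[k] W),
      (∀ (v : kerShift k p V) (w : kerShift k p W) (u : kerShift k p (V ⊗[k] W)),
        (u : ⨂[k] _ : Fin p, V ⊗[k] W) = Θ ((v : ⨂[k] _ : Fin p, V) ⊗ₜ[k] (w : ⨂[k] _ : Fin p, W)) →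
          θ ((Submodule.Quotient.mk v) ⊗ₜ[k] (Submodule.Quotient.mk w)) =
            Submodule.Quotient.mk u) ∧
      Function.Bijective θ := by
  have : NeZero p := ⟨hp.ne_zero⟩
  refine ⟨fun v hv w hw => ?_, ?_, ?_, ?_⟩
  · rw [mem_kerShift, ← interleave_cyclicShift hΘ, mem_kerShift.1 hv, mem_kerShift.1 hw]
  · rintro _ ⟨v, rfl⟩ w hw
    refine ⟨Θ (v ⊗ₜ[k] w), ?_⟩
    simp only [normOp, LinearMap.sum_apply, TensorProduct.sum_tmul, map_sum,
      ← interleave_cyclicShift_pow hΘ, cyclicShift_pow_apply_of_mem hw]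
  · rintro v hv _ ⟨w, rfl⟩
    refine ⟨Θ (v ⊗ₜ[k] w), ?_⟩
    simp only [normOp, LinearMap.sum_apply, TensorProduct.tmul_sum, map_sum,
      ← interleave_cyclicShift_pow hΘ, cyclicShift_pow_apply_of_mem hv]
  · let b := Basis.ofVectorSpace k V
    let c := Basis.ofVectorSpace k W
    let θ : (Tate k p V ⊗[k] Tate k p W) ≃ₗ[k] Tate k p (V ⊗[k] W) :=
      TensorProduct.congr (tateEquiv b) (tateEquiv c) ≪≫ₗ finsuppTensorFinsupp' k _ _ ≪≫ₗ
        (tateEquiv (b.tensorProduct c)).symm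
    refine ⟨θ.toLinearMap, fun v w u hu => ?_, θ.bijective⟩
    apply (tateEquiv (b.tensorProduct c)).injective
    rw [tateEquiv_mk, hu, diagCoeff_interleave b c hΘ]
    simp [θ, tateEquiv_mk]

end
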